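/- For every integer n ≥ 2 and every integer k with 2 ≤ k ≤ n, the number of type-B permutation tableaux of size n whose (k-1)-th and k-th border steps are both south steps equals ((n-k+1)^2/(4n(n-1)))·|B_n|; equivalently, for a uniformly random type-B permutation tableau of size n, the probability that steps k-1 and k are both south steps is (n-k+1)^2/(4n(n-1)). -/

import Mathlib

/-- A type-B permutation tableau of size `n`, encoded via its border steps and filling.

Border steps are indexed by `Fin n` (index `i` is the `(i+1)`-th step from the
northeast corner); `west i = true` means the `(i+1)`-th step is a west step
(giving a column) and `west i = false` means it is a south step (giving a row
of the original, unshifted diagram).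

Rows of the shifted diagram are also indexed by `Fin n`: a south step `r` indexes
the corresponding original row, and a west step `r` indexes the inserted diagonal
row whose diagonal cell lies in the column of `r`.  The cell in row `r` and the
column of a west step `c` exists iff (`r` is south and `r < c`) or (`r` is west
and `r ≤ c`); in particular the diagonal cell of the column of `c` is `(c, c)`.
Columns are ordered left-to-right by decreasing step index, rows top-to-bottom as:
diagonal rows by decreasing step index, then original rows by increasing step index.

`filling r c = true` means the cell `(r, c)` contains a 1; `filling` is `false`
outside the cells of the diagram (field `support`).  The fields `col_one`,
`no_bad_zero` and `diag_zero` are the three defining conditions of a type-B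
permutation tableau. -/
structure TypeBTableau (n : ℕ) where
  west : Fin n → Bool
  filling : Fin n → Fin n → Bool
  support : ∀ r c : Fin n, filling r c = true →
    west c = true ∧ ((west r = false ∧ (r : ℕ) < (c : ℕ)) ∨ (west r = true ∧ (r : ℕ) ≤ (c : ℕ)))
  col_one : ∀ c : Fin n, west c = true → ∃ r : Fin n, filling r c = true
  no_bad_zero : ∀ r c : Fin n,
    (west c = true ∧ ((west r = false ∧ (r : ℕ) < (c : ℕ)) ∨ (west r = true ∧ (r : ℕ) ≤ (c : ℕ)))) →
    filling r c = false →
    ¬((∃ r' : Fin n,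
        ((west r' = true ∧ west r = false) ∨
         (west r' = true ∧ west r = true ∧ (r : ℕ) < (r' : ℕ)) ∨
         (west r' = false ∧ west r = false ∧ (r' : ℕ) < (r : ℕ))) ∧
        filling r' c = true) ∧
      (∃ c' : Fin n, (c : ℕ) < (c' : ℕ) ∧ filling r c' = true))
  diag_zero : ∀ j : Fin n, west j = true → filling j j = false →
    ∀ c : Fin n, filling j c = false

namespace TypeBTableau

noncomputable instance instFintype {n : ℕ} : Fintype (TypeBTableau n) :=
  Fintype.ofInjective (fun T => (T.west, T.filling)) (by
    rintro ⟨w1, f1, _, _, _, _⟩ ⟨w2, f2, _, _, _, _⟩ h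
    simp only [Prod.mk.injEq] at h
    obtain ⟨h1, h2⟩ := h
    subst h1; subst h2; rfl)

end TypeBTableau

open Finset

namespace TypeBTableau

variable {n : ℕ}

def Above (w : Fin n → Bool) (r' r : Fin n) : Prop :=
  (w r' = true ∧ w r = false) ∨
    (w r' = true ∧ w r = true ∧ (r : ℕ) < (r' : ℕ)) ∨
    (w r' = false ∧ w r = false ∧ (r' : ℕ) < (r : ℕ))

def Cell (w : Fin n → Bool) (r c : Fin n) : Prop :=
  w c = true ∧ ((w r = false ∧ (r : ℕ) < (c : ℕ)) ∨ (w r = true ∧ (r : ℕ) ≤ (c : ℕ)))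

def key (w : Fin n → Bool) (r : Fin n) : ℤ := if w r = true then -((r : ℕ) : ℤ) - 1 else ((r : ℕ) : ℤ)

lemma above_iff (w : Fin n → Bool) (r' r : Fin n) : Above w r' r ↔ key w r' < key w r := by
  unfold Above key
  cases w r <;> cases w r' <;> simp <;> omega

lemma key_inj (w : Fin n → Bool) : Function.Injective (key w) := by
  intro a b h
  unfold key at h
  ext
  cases ha : w a <;> cases hb : w b <;> simp [ha, hb] at h <;> omega

def UnresP (T : TypeBTableau n) (r : Fin n) : Prop :=
  (T.west r = true → T.filling r r = true) ∧
    ∀ c, Cell T.west r c → T.filling r c = false → ∀ r', Above T.west r' r → T.filling r' c = false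

open Classical in
noncomputable def Unres (T : TypeBTableau n) : Finset (Fin n) := Finset.univ.filter T.UnresP

lemma ext' {T T' : TypeBTableau n} (h1 : T.west = T'.west) (h2 : T.filling = T'.filling) : T = T' := by
  cases T; cases T'; simp at h1 h2; subst h1; subst h2; rfl

def restr (T : TypeBTableau (n + 1)) : TypeBTableau n where
  west r := T.west r.castSucc
  filling r c := T.filling r.castSucc c.castSucc
  support r c h := by simpa using T.support _ _ h
  col_one c h := by
    obtain ⟨r, hr⟩ := T.col_one _ h
    have := T.support _ _ hr
    have hlt : (r : ℕ) < n := by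
      have h2 := c.2
      simp only [Fin.val_castSucc] at this
      omega
    exact ⟨⟨r, hlt⟩, hr⟩
  no_bad_zero r c h h0 := by
    rintro ⟨⟨r', h1, h2⟩, ⟨c', h3, h4⟩⟩
    exact T.no_bad_zero r.castSucc c.castSucc (by simpa using h) h0
      ⟨⟨r'.castSucc, by simpa using h1, h2⟩, ⟨c'.castSucc, by simpa using h3, h4⟩⟩
  diag_zero j h h0 c := T.diag_zero _ h h0 _

def col (T : TypeBTableau (n + 1)) : Finset (Fin n) :=
  Finset.univ.filter fun r => T.filling r.castSucc (Fin.last n) = true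

lemma mem_col (T : TypeBTableau (n + 1)) (r : Fin n) :
    r ∈ T.col ↔ T.filling r.castSucc (Fin.last n) = true := by simp [col]

lemma not_fill_last (T : TypeBTableau (n + 1)) (c : Fin n) :
    T.filling (Fin.last n) c.castSucc = false := by
  by_contra h
  have := T.support _ _ (by simpa using h)
  have h2 := c.2
  simp only [Fin.val_castSucc, Fin.val_last] at this
  omega

lemma ext_data {T T' : TypeBTableau (n + 1)} (hr : T.restr = T'.restr)
    (hw : T.west (Fin.last n) = T'.west (Fin.last n))
    (hb : T.filling (Fin.last n) (Fin.last n) = T'.filling (Fin.last n) (Fin.last n))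
    (hc : T.col = T'.col) : T = T' := by
  apply ext'
  · funext i
    refine Fin.lastCases hw (fun i => ?_) i
    exact congrFun (congrArg TypeBTableau.west hr) i
  · funext i j
    refine Fin.lastCases ?_ (fun i => ?_) i
    · refine Fin.lastCases hb (fun j => ?_) j
      rw [not_fill_last, not_fill_last]
    · refine Fin.lastCases ?_ (fun j => ?_) j
      · have := Finset.ext_iff.1 hc i
        rw [mem_col, mem_col] at this
        exact Bool.eq_iff_iff.2 this
      · exact congrFun (congrFun (congrArg TypeBTableau.filling hr) i) j

lemma col_subset (T : TypeBTableau (n + 1)) : T.col ⊆ T.restr.Unres := by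
  intro r hr
  rw [mem_col] at hr
  simp only [Unres, Finset.mem_filter, Finset.mem_univ, true_and]
  refine ⟨fun hw => ?_, fun c hc h0 r' ha => ?_⟩
  · by_contra h
    have := T.diag_zero r.castSucc hw (by simpa [restr] using h) (Fin.last n)
    simp [hr] at this
  · by_contra h
    exact T.no_bad_zero r.castSucc c.castSucc hc h0
      ⟨⟨r'.castSucc, ha, by simpa [restr] using h⟩, ⟨Fin.last n, by simp, hr⟩⟩

/-- extend a tableau by one step -/
def extd (T : TypeBTableau n) (w b : Bool) (S : Finset (Fin n)) (hS : S ⊆ T.Unres)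
    (h1 : w = true → b = true ∨ S.Nonempty) (h2 : w = false → b = false ∧ S = ∅) :
    TypeBTableau (n + 1) where
  west := Fin.snoc (α := fun _ => Bool) T.west w
  filling := Fin.snoc (α := fun _ => Fin (n + 1) → Bool)
    (fun r => Fin.snoc (α := fun _ => Bool) (T.filling r) (decide (r ∈ S)))
    (Fin.snoc (α := fun _ => Bool) (fun _ => false) b)
  support := by
    simp only [Fin.forall_fin_succ', Fin.snoc_castSucc, Fin.snoc_last, Fin.val_castSucc, Fin.val_last]
    refine ⟨fun r => ⟨fun c => T.support r c, fun h => ?_⟩, fun c h => by simp at h, fun h => ?_⟩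
    · have hr := r.2
      cases w
      · simp [(h2 rfl).2] at h
      · cases T.west r <;> simp [hr, hr.le]
    · cases w
      · simp [(h2 rfl).1] at h
      · simp
  col_one := by
    simp only [Fin.forall_fin_succ', Fin.exists_fin_succ', Fin.snoc_castSucc, Fin.snoc_last]
    refine ⟨fun c h => Or.inl (T.col_one c h), fun h => ?_⟩
    rcases h1 h with h | ⟨s, hs⟩
    · exact Or.inr h
    · exact Or.inl ⟨s, by simpa using hs⟩
  no_bad_zero := by
    simp only [Fin.forall_fin_succ', Fin.exists_fin_succ', Fin.snoc_castSucc, Fin.snoc_last,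
      Fin.val_castSucc, Fin.val_last]
    refine ⟨fun r => ⟨fun c hc h0 => ?_, fun hc h0 => ?_⟩, fun c hc h0 => ?_, fun hc h0 => ?_⟩
    · rintro ⟨h3 | h3, h4⟩
      · rcases h4 with h4 | ⟨-, h4⟩
        · exact T.no_bad_zero r c hc h0 ⟨h3, h4⟩
        · have h5 := hS (by simpa using h4)
          simp only [Unres, Finset.mem_filter, Finset.mem_univ, true_and] at h5
          obtain ⟨r', h6, h7⟩ := h3
          have := h5.2 c hc h0 r' h6
          simp [h7] at this
      · simp at h3
    · rintro ⟨-, ⟨c', h, -⟩ | ⟨h, -⟩⟩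
      · have := c'.2; omega
      · omega
    · have := c.2; omega
    · rintro ⟨-, ⟨c', h, -⟩ | ⟨h, -⟩⟩
      · have := c'.2; omega
      · omega
  diag_zero := by
    simp only [Fin.forall_fin_succ', Fin.snoc_castSucc, Fin.snoc_last]
    refine ⟨fun r hw h0 => ⟨fun c => T.diag_zero r hw h0 c, ?_⟩, fun hw hb => ⟨fun _ => trivial, hb⟩⟩
    by_contra h
    have h5 := hS (by simpa using h)
    simp only [Unres, Finset.mem_filter, Finset.mem_univ, true_and] at h5
    have := h5.1 hw
    simp [h0] at this

section
variable (T : TypeBTableau n) (w b : Bool) (S : Finset (Fin n)) (hS : S ⊆ T.Unres)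
    (h1 : w = true → b = true ∨ S.Nonempty) (h2 : w = false → b = false ∧ S = ∅)

lemma restr_extd : (T.extd w b S hS h1 h2).restr = T := by
  apply ext'
  · funext i; simp [restr, extd]
  · funext i j; simp [restr, extd]

lemma col_extd : (T.extd w b S hS h1 h2).col = S := by
  ext i; simp [col, extd]

lemma west_extd : (T.extd w b S hS h1 h2).west (Fin.last n) = w := by simp [extd]

lemma diag_extd : (T.extd w b S hS h1 h2).filling (Fin.last n) (Fin.last n) = b := by simp [extd]
end

lemma unresP_last (T : TypeBTableau (n + 1)) :
    T.UnresP (Fin.last n) ↔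
      (T.west (Fin.last n) = true → T.filling (Fin.last n) (Fin.last n) = true) := by
  refine ⟨fun h => h.1, fun h => ⟨h, fun c hc h0 => ?_⟩⟩
  have hcl : c = Fin.last n := by
    have := c.2
    have h3 := hc.2
    ext
    simp only [Fin.val_last] at *
    omega
  subst hcl
  simp [h hc.1] at h0

lemma unresP_castSucc (T : TypeBTableau (n + 1)) (r : Fin n) :
    T.UnresP r.castSucc ↔ T.restr.UnresP r ∧ (T.west (Fin.last n) = true → 
      (r ∈ T.col ∨ (T.filling (Fin.last n) (Fin.last n) = false ∧
        ∀ s ∈ T.col, ¬ key T.restr.west s < key T.restr.west r))) := by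
  constructor
  · rintro ⟨h1, h2⟩
    refine ⟨⟨h1, fun c hc h0 r' ha => h2 c.castSucc (by exact hc) h0 r'.castSucc
      (by exact ha)⟩, fun hw => ?_⟩
    rw [or_iff_not_imp_left]
    intro hr
    rw [mem_col] at hr
    have hr2 := r.2
    have h3 := h2 (Fin.last n) (by cases h : T.west r.castSucc <;> simp [Cell, hw, h, hr2.le])
      (by simpa using hr)
    refine ⟨h3 _ (by cases h : T.west r.castSucc <;> simp [Above, hw, h]), fun s hs hk => ?_⟩
    rw [← above_iff] at hk
    rw [mem_col, h3 s.castSucc (by exact hk)] at hs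
    simp at hs
  · rintro ⟨⟨h1, h2⟩, h3⟩
    refine ⟨h1, fun c => ?_⟩
    refine Fin.lastCases (fun hc h0 => ?_) (fun c hc h0 => ?_) c
    · have h4 := (h3 hc.1).resolve_left (by rw [mem_col]; simp [h0])
      intro r'
      refine Fin.lastCases (fun _ => h4.1) (fun r' ha => ?_) r'
      by_contra h
      refine h4.2 r' (by rw [mem_col]; simpa using h) ?_
      rw [← above_iff]
      exact ha
    · intro r'
      refine Fin.lastCases (fun _ => not_fill_last T c) (fun r' ha => ?_) r'
      exact h2 c (by exact hc) h0 r' (by exact ha)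

open Classical in
lemma card_unres (T : TypeBTableau (n + 1)) :
    T.Unres.card = (if (T.west (Fin.last n) = true → T.filling (Fin.last n) (Fin.last n) = true)
      then 1 else 0) +
      (T.restr.Unres.filter fun r => T.west (Fin.last n) = true → 
      (r ∈ T.col ∨ (T.filling (Fin.last n) (Fin.last n) = false ∧
        ∀ s ∈ T.col, ¬ key T.restr.west s < key T.restr.west r))).card := by
  unfold Unres
  rw [Finset.filter_filter]
  simp only [← unresP_castSucc, ← unresP_last, Finset.card_filter]
  rw [Fin.sum_univ_castSucc, add_comm]

open Classical in
lemma subset_sum (f : Fin n → ℤ) (hf : Function.Injective f) (x : ℝ) (U : Finset (Fin n)) :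
    ∑ S ∈ U.powerset, x ^ (U.filter fun r => r ∈ S ∨ ∀ s ∈ S, ¬ f s < f r).card
      = x * (1 + x) ^ U.card - x ^ (U.card + 1) + x ^ U.card := by
  induction U using Finset.induction_on_min_value f with
  | empty => simp
  | insert a U ha hmin ih =>
    have hlt : ∀ r ∈ U, f a < f r := fun r hr =>
      lt_of_le_of_ne (hmin r hr) (fun h => ha (hf h ▸ hr))
    rw [Finset.sum_powerset_insert ha]
    have e1 : ∀ S ∈ U.powerset, x ^ ((insert a U).filter fun r => r ∈ S ∨ ∀ s ∈ S, ¬ f s < f r).card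
        = x * x ^ (U.filter fun r => r ∈ S ∨ ∀ s ∈ S, ¬ f s < f r).card := by
      intro S hS
      rw [Finset.mem_powerset] at hS
      rw [Finset.filter_insert, if_pos, Finset.card_insert_of_notMem, pow_succ']
      · simp [ha]
      · exact Or.inr fun s hs => not_lt.2 (hlt s (hS hs)).le
    have e2 : ∀ S ∈ U.powerset, x ^ ((insert a U).filter fun r => r ∈ insert a S ∨
          ∀ s ∈ insert a S, ¬ f s < f r).card = x * x ^ S.card := by
      intro S hS
      rw [Finset.mem_powerset] at hS
      have : ((insert a U).filter fun r => r ∈ insert a S ∨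
          ∀ s ∈ insert a S, ¬ f s < f r) = insert a S := by
        ext r
        simp only [Finset.mem_filter, Finset.mem_insert]
        constructor
        · rintro ⟨rfl | h, h1 | h1⟩
          · exact h1
          · simp
          · exact h1
          · exact absurd (hlt r h) (h1 a (Or.inl rfl))
        · rintro (rfl | h)
          · simp
          · exact ⟨Or.inr (hS h), Or.inl (Or.inr h)⟩
      rw [this, Finset.card_insert_of_notMem (fun h => ha (hS h)), pow_succ']
    rw [Finset.sum_congr rfl e1, Finset.sum_congr rfl e2, ← Finset.mul_sum, ← Finset.mul_sum, ih,
      Finset.card_insert_of_notMem ha]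
    have e3 : ∑ S ∈ U.powerset, x ^ S.card = (1 + x) ^ U.card := by
      have := Finset.sum_pow_mul_eq_add_pow x 1 U
      simp only [one_pow, mul_one] at this
      rw [this, add_comm]
    rw [e3]
    ring

open Classical in
lemma fiber_south (T : TypeBTableau n) (x : ℝ) :
    ∑ T' : TypeBTableau (n + 1) with T'.restr = T ∧ T'.west (Fin.last n) = false, x ^ T'.Unres.card
      = x ^ (T.Unres.card + 1) := by
  have hs : (Finset.univ.filter fun T' : TypeBTableau (n + 1) =>
      T'.restr = T ∧ T'.west (Fin.last n) = false) =
      {T.extd false false ∅ (by simp) (by simp) (by simp)} := by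
    ext T'
    simp only [Finset.mem_filter, Finset.mem_univ, true_and, Finset.mem_singleton]
    constructor
    · rintro ⟨h1, h2⟩
      apply ext_data
      · rw [h1, restr_extd]
      · rw [h2, west_extd]
      · rw [diag_extd]
        by_contra h
        have := T'.support _ _ (by simpa using h)
        simp [h2] at this
      · rw [col_extd, Finset.eq_empty_iff_forall_notMem]
        intro r hr
        rw [mem_col] at hr
        have := T'.support _ _ hr
        simp [h2] at this
    · rintro rfl
      exact ⟨restr_extd .., west_extd ..⟩
  rw [hs, Finset.sum_singleton, card_unres]
  simp [restr_extd, west_extd, add_comm]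

open Classical in
lemma fiber_west1 (T : TypeBTableau n) (x : ℝ) :
    ∑ T' : TypeBTableau (n + 1) with T'.restr = T ∧ T'.west (Fin.last n) = true ∧
      T'.filling (Fin.last n) (Fin.last n) = true, x ^ T'.Unres.card
      = x * (1 + x) ^ T.Unres.card := by
  have e3 : ∑ S ∈ T.Unres.powerset, x * x ^ S.card = x * (1 + x) ^ T.Unres.card := by
    have := Finset.sum_pow_mul_eq_add_pow x 1 T.Unres
    simp only [one_pow, mul_one] at this
    rw [← Finset.mul_sum, this, add_comm]
  rw [← e3]
  refine Finset.sum_bij (fun T' _ => T'.col) ?_ ?_ ?_ ?_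
  · intro T' h
    simp only [Finset.mem_filter, Finset.mem_univ, true_and] at h
    rw [Finset.mem_powerset, ← h.1]
    exact col_subset T'
  · intro T1 h1 T2 h2 h
    simp only [Finset.mem_filter, Finset.mem_univ, true_and] at h1 h2
    exact ext_data (h1.1.trans h2.1.symm) (h1.2.1.trans h2.2.1.symm) (h1.2.2.trans h2.2.2.symm) h
  · intro S hS
    rw [Finset.mem_powerset] at hS
    refine ⟨T.extd true true S hS (by simp) (by simp), ?_, col_extd ..⟩
    simp [restr_extd, west_extd, diag_extd]
  · intro T' h
    simp only [Finset.mem_filter, Finset.mem_univ, true_and] at h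
    have hs := col_subset T'
    rw [card_unres, h.1, h.2.1, h.2.2]
    rw [h.1] at hs
    simp only [if_true, true_imp_iff, reduceCtorEq, false_and, or_false]
    rw [Finset.filter_mem_eq_inter, Finset.inter_eq_right.2 hs, add_comm, pow_succ']

open Classical in
lemma fiber_west2 (T : TypeBTableau n) (x : ℝ) :
    ∑ T' : TypeBTableau (n + 1) with T'.restr = T ∧ T'.west (Fin.last n) = true ∧
      T'.filling (Fin.last n) (Fin.last n) = false, x ^ T'.Unres.card
      = x * (1 + x) ^ T.Unres.card - x ^ (T.Unres.card + 1) := by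
  have e3 := subset_sum (key T.west) (key_inj _) x T.Unres
  rw [← Finset.add_sum_erase _ _ (Finset.empty_mem_powerset T.Unres)] at e3
  simp only [Finset.notMem_empty, false_imp_iff, implies_true, or_true, Finset.filter_true] at e3
  rw [add_comm, add_right_cancel_iff] at e3
  rw [← e3]
  refine Finset.sum_bij (fun T' _ => T'.col) ?_ ?_ ?_ ?_
  · intro T' h
    simp only [Finset.mem_filter, Finset.mem_univ, true_and] at h
    rw [Finset.mem_erase, Finset.mem_powerset, ← h.1]
    refine ⟨?_, col_subset T'⟩
    obtain ⟨r, hr⟩ := T'.col_one _ h.2.1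
    rw [← Finset.nonempty_iff_ne_empty]
    revert hr
    refine Fin.lastCases (fun hr => ?_) (fun r hr => ⟨r, (mem_col _ _).2 hr⟩) r
    simp [h.2.2] at hr
  · intro T1 h1 T2 h2 h
    simp only [Finset.mem_filter, Finset.mem_univ, true_and] at h1 h2
    exact ext_data (h1.1.trans h2.1.symm) (h1.2.1.trans h2.2.1.symm) (h1.2.2.trans h2.2.2.symm) h
  · intro S hS
    rw [Finset.mem_erase, Finset.mem_powerset, ← Finset.nonempty_iff_ne_empty] at hS
    refine ⟨T.extd true false S hS.2 (fun _ => Or.inr hS.1) (by simp), ?_, col_extd ..⟩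
    simp [restr_extd, west_extd, diag_extd]
  · intro T' h
    simp only [Finset.mem_filter, Finset.mem_univ, true_and] at h
    rw [card_unres, h.1, h.2.1, h.2.2]
    simp

open Classical in
lemma fiber_all (T : TypeBTableau n) (x : ℝ) :
    ∑ T' : TypeBTableau (n + 1) with T'.restr = T, x ^ T'.Unres.card
      = 2 * x * (1 + x) ^ T.Unres.card := by
  rw [← Finset.sum_filter_add_sum_filter_not _ (fun T' => T'.west (Fin.last n) = false),
    ← Finset.sum_filter_add_sum_filter_not (Finset.filter (fun T' : TypeBTableau (n + 1) =>
      ¬ T'.west (Fin.last n) = false) _) (fun T' => T'.filling (Fin.last n) (Fin.last n) = true)]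
  simp only [Finset.filter_filter, Bool.not_eq_false, Bool.not_eq_true, and_assoc]
  rw [fiber_south, fiber_west1, fiber_west2]
  ring

/-- weighted generating function -/
noncomputable def gen (n : ℕ) (g : TypeBTableau n → ℝ) (x : ℝ) : ℝ :=
  ∑ T : TypeBTableau n, g T * x ^ T.Unres.card

lemma gen_restr (g : TypeBTableau n → ℝ) (x : ℝ) :
    gen (n + 1) (fun T => g T.restr) x = 2 * x * gen n g (1 + x) := by
  classical
  unfold gen
  rw [← Finset.sum_fiberwise _ (fun T' : TypeBTableau (n + 1) => T'.restr), Finset.mul_sum]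
  refine Finset.sum_congr rfl fun T _ => ?_
  rw [mul_left_comm, ← fiber_all, Finset.mul_sum]
  refine Finset.sum_congr rfl fun T' h => ?_
  simp only [(Finset.mem_filter.1 h).2]

lemma gen_south (g : TypeBTableau n → ℝ) (x : ℝ) :
    gen (n + 1) (fun T => if T.west (Fin.last n) = false then g T.restr else 0) x
      = x * gen n g x := by
  classical
  unfold gen
  simp only [ite_mul, zero_mul]
  rw [← Finset.sum_filter, ← Finset.sum_fiberwise _ (fun T' : TypeBTableau (n + 1) => T'.restr),
    Finset.mul_sum]
  refine Finset.sum_congr rfl fun T _ => ?_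
  rw [mul_left_comm, ← pow_succ', ← fiber_south, Finset.mul_sum, Finset.filter_filter]
  simp only [and_comm]
  refine Finset.sum_congr rfl fun T' h => ?_
  rw [(Finset.mem_filter.1 h).2.1]

lemma gen_one (n : ℕ) (x : ℝ) :
    gen n (fun _ => 1) x = 2 ^ n * ∏ i ∈ Finset.range n, (x + i) := by
  induction n generalizing x with
  | zero =>
    let T0 : TypeBTableau 0 := ⟨fun _ => true, fun _ _ => true, fun r => r.elim0, fun r => r.elim0,
      fun r => r.elim0, fun r => r.elim0⟩
    have hu : (Finset.univ : Finset (TypeBTableau 0)) = {T0} := by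
      ext T
      simp only [Finset.mem_univ, Finset.mem_singleton, true_iff]
      apply ext' <;> funext i <;> exact i.elim0
    have : T0.Unres = ∅ := Subsingleton.elim _ _
    simp [gen, hu, this]
  | succ n ih =>
    have := gen_restr (n := n) (fun _ => 1) x
    rw [this, ih, Finset.prod_range_succ']
    have e : ∀ i : ℕ, x + ((i + 1 : ℕ) : ℝ) = 1 + x + i := fun i => by push_cast; ring
    simp only [e]
    push_cast
    ring

open Classical in
noncomputable def ind (n j : ℕ) (T : TypeBTableau n) : ℝ :=
  if ∀ i : Fin n, ((i : ℕ) = j ∨ (i : ℕ) = j + 1) → T.west i = false then 1 else 0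

lemma gen_ind (j m : ℕ) (x : ℝ) :
    gen (j + 2 + m) (ind _ j) x
      = 2 ^ (j + m) * (∏ i ∈ Finset.range (m + j), (x + i)) * (x + m) ^ 2 := by
  induction m generalizing x with
  | zero =>
    have h1 := gen_south (n := j + 1)
      (fun T => if T.west (Fin.last j) = false then (fun _ => (1 : ℝ)) T.restr else 0) x
    have h0 := gen_south (n := j) (fun _ => 1) x
    rw [gen_one] at h0
    replace h1 := h1.trans (congrArg (x * ·) h0)
    have h2 : ind (j + 2) j = fun T : TypeBTableau (j + 2) =>
        if T.west (Fin.last (j + 1)) = false then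
          (fun T : TypeBTableau (j + 1) =>
            if T.west (Fin.last j) = false then (fun _ => (1 : ℝ)) T.restr else 0) T.restr else 0 := by
      funext T
      simp only [ind, Fin.forall_fin_succ', restr, Fin.val_castSucc, Fin.val_last]
      have : ∀ i : Fin j, ((i : ℕ) = j ∨ (i : ℕ) = j + 1 → T.west i.castSucc.castSucc = false) := by
        intro i hi
        have := i.2
        omega
      by_cases ha : T.west (Fin.last (j + 1)) = false <;>
      by_cases hb : T.west (Fin.last j).castSucc = false <;> simp [ha, hb]
      exact this
    show gen (j + 2) (ind (j + 2) j) x = _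
    rw [h2, h1]
    simp
    ring
  | succ m ih =>
    have h1 := gen_restr (ind (j + 2 + m) j) x
    have h2 : ind (j + 2 + m + 1) j = fun T => ind (j + 2 + m) j T.restr := by
      funext T
      simp only [ind, Fin.forall_fin_succ', restr, Fin.val_castSucc, Fin.val_last]
      have : ¬ (j + 2 + m = j ∨ j + 2 + m = j + 1) := by omega
      simp only [this, false_imp_iff, and_true]
      congr
    show gen (j + 2 + m + 1) (ind (j + 2 + m + 1) j) x = _
    rw [h2, h1, ih, show m + 1 + j = (m + j) + 1 by ring, Finset.prod_range_succ']
    have e : ∀ i : ℕ, x + ((i + 1 : ℕ) : ℝ) = 1 + x + i := fun i => by push_cast; ring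
    simp only [e]
    push_cast
    ring

end TypeBTableau

/-- The number of type-B permutation tableaux of size `n` whose `(k-1)`-th and
`k`-th border steps are both south steps equals `((n-k+1)² / (4n(n-1))) · |B_n|`;
i.e. for a uniformly random type-B permutation tableau of size `n`, the
probability that steps `k-1` and `k` are both south is `(n-k+1)² / (4n(n-1))`. -/
theorem expected_adjacent_south_steps (n k : ℕ) (hn : 2 ≤ n) (hk : 2 ≤ k) (hkn : k ≤ n) :
    ((Finset.univ.filter (fun T : TypeBTableau n =>
        T.west ⟨k - 2, by omega⟩ = false ∧ T.west ⟨k - 1, by omega⟩ = false)).card : ℝ) =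
      ((n : ℝ) - (k : ℝ) + 1) ^ 2 / (4 * (n : ℝ) * ((n : ℝ) - 1)) *
        (Fintype.card (TypeBTableau n) : ℝ) := by
  classical
  obtain ⟨j, rfl⟩ : ∃ j, k = j + 2 := ⟨k - 2, by omega⟩
  obtain ⟨m, rfl⟩ : ∃ m, n = j + 2 + m := ⟨n - (j + 2), by omega⟩
  have hA := TypeBTableau.gen_ind j m 1
  have hB := TypeBTableau.gen_one (j + 2 + m) 1
  have eB : (Fintype.card (TypeBTableau (j + 2 + m)) : ℝ)
      = TypeBTableau.gen (j + 2 + m) (fun _ => 1) 1 := by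
    simp [TypeBTableau.gen]
  have eA : ((Finset.univ.filter (fun T : TypeBTableau (j + 2 + m) =>
        T.west ⟨j + 2 - 2, by omega⟩ = false ∧ T.west ⟨j + 2 - 1, by omega⟩ = false)).card : ℝ)
      = TypeBTableau.gen (j + 2 + m) (TypeBTableau.ind _ j) 1 := by
    simp only [TypeBTableau.gen, TypeBTableau.ind, one_pow, mul_one]
    rw [Finset.sum_boole]
    congr 2
    ext T
    simp only [Finset.mem_filter, Finset.mem_univ, true_and]
    constructor
    · rintro ⟨h1, h2⟩ i (hi | hi)
      · rw [← h1]; congr 1; ext; simpa using hi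
      · rw [← h2]; congr 1; ext; simpa using hi
    · intro h
      exact ⟨h _ (by simp), h _ (by simp)⟩
  rw [eA, eB, hA, hB, show j + 2 + m = (m + j) + 1 + 1 by ring, Finset.prod_range_succ,
    Finset.prod_range_succ]
  have h1 : ((m : ℝ) + j + 1) ≠ 0 := by positivity
  have h2 : ((m : ℝ) + j + 2) ≠ 0 := by positivity
  push_cast
  have h3 : ((m : ℝ) + j + 1 + 1 - 1) = m + j + 1 := by ring
  have h4 : ((m : ℝ) + j + 1 + 1) = m + j + 2 := by ring
  rw [h3, h4]
  field_simp
  ring
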